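/- (Steiner's inequality for Lebesgue area) For continuous functions f₁, f₂ : Q → ℝ on Q = [0,1]², the Lebesgue area satisfies L_Q[(f₁+f₂)/2] ≤ (L_Q[f₁] + L_Q[f₂])/2. The key pointwise ingredient is: for real numbers aᵢ, bᵢ, cᵢ, Σᵢ(aᵢ² + bᵢ² + cᵢ²)^{1/2} ≥ [(Σᵢaᵢ)² + (Σᵢbᵢ)² + (Σᵢcᵢ)²]^{1/2}. -/

import Mathlib

open MeasureTheory Set Filter Topology
open scoped ENNReal

/-- The unit square `Q = [0,1] × [0,1]` in the plane. -/
def unitSquare : Set (ℝ × ℝ) := Set.Icc (0, 0) (1, 1)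

/-- The (closed) triangle with the given three vertices. -/
def triangle2 (A B C : ℝ × ℝ) : Set (ℝ × ℝ) := convexHull ℝ ({A, B, C} : Set (ℝ × ℝ))

/-- `f` is quasi linear on the unit square: it is continuous there and there is a finite
decomposition of the square into nonoverlapping triangles on each of which `f` is
(affine) linear. -/
def IsQuasiLinear (f : ℝ × ℝ → ℝ) : Prop :=
  ContinuousOn f unitSquare ∧
  ∃ (N : ℕ) (V : Fin N → Fin 3 → ℝ × ℝ),
    (⋃ i, triangle2 (V i 0) (V i 1) (V i 2)) = unitSquare ∧
    (∀ i j, i ≠ j →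
      interior (triangle2 (V i 0) (V i 1) (V i 2)) ∩
        interior (triangle2 (V j 0) (V j 1) (V j 2)) = ∅) ∧
    (∀ i, ∃ a b c : ℝ, ∀ p ∈ triangle2 (V i 0) (V i 1) (V i 2),
      f p = a * p.1 + b * p.2 + c)

/-- The elementary area of a quasi linear function: the sum of the areas of the image
triangles in ℝ³, which equals `∬_Q √(1 + fₓ² + f_y²)`. -/
noncomputable def elemArea (f : ℝ × ℝ → ℝ) : ℝ :=
  ∫ p in unitSquare,
    Real.sqrt (1 + (fderiv ℝ f p (1, 0)) ^ 2 + (fderiv ℝ f p (0, 1)) ^ 2)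

/-- The Lebesgue area of `f : Q → ℝ`: the infimum, over all sequences of quasi linear
functions converging uniformly on `Q` to `f`, of the liminf of the elementary areas. -/
noncomputable def LebesgueArea (f : ℝ × ℝ → ℝ) : ℝ≥0∞ :=
  ⨅ s : {s : ℕ → (ℝ × ℝ → ℝ) // (∀ n, IsQuasiLinear (s n)) ∧
      TendstoUniformlyOn s f atTop unitSquare},
    Filter.liminf (fun n => ENNReal.ofReal (elemArea (s.1 n))) atTop

/-- Affine function from coefficients. -/
def aff (d : ℝ × ℝ × ℝ) (p : ℝ × ℝ) : ℝ := d.1 * p.1 + d.2.1 * p.2 + d.2.2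

lemma aff_comb (d : ℝ × ℝ × ℝ) (p q : ℝ × ℝ) (s t : ℝ) (h : s + t = 1) :
    aff d (s • p + t • q) = s * aff d p + t * aff d q := by
  have : s = 1 - t := by linarith
  subst this
  simp [aff]; ring

/-- Weak constancy of sign. -/
def Sgn (d : ℝ × ℝ × ℝ) (S : Set (ℝ × ℝ)) : Prop :=
  (∀ x ∈ S, 0 ≤ aff d x) ∨ (∀ x ∈ S, aff d x ≤ 0)

/-- Decomposability into nonoverlapping triangles with a property. -/
def Dec (S : Set (ℝ × ℝ)) (P : Set (ℝ × ℝ) → Prop) : Prop :=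
  ∃ (ι : Type) (_ : Finite ι) (V : ι → Fin 3 → ℝ × ℝ),
    (⋃ i, triangle2 (V i 0) (V i 1) (V i 2)) = S ∧
    (∀ i j, i ≠ j →
      interior (triangle2 (V i 0) (V i 1) (V i 2)) ∩
        interior (triangle2 (V j 0) (V j 1) (V j 2)) = ∅) ∧
    (∀ i, P (triangle2 (V i 0) (V i 1) (V i 2)))

lemma Dec.single {A B C : ℝ × ℝ} {P : Set (ℝ × ℝ) → Prop} (h : P (triangle2 A B C)) :
    Dec (triangle2 A B C) P := by
  refine ⟨Unit, inferInstance, fun _ => ![A, B, C], ?_, ?_, ?_⟩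
  · simp [Set.iUnion_const]
  · intro i j hij; exact absurd (Subsingleton.elim i j) hij
  · intro i; simpa using h

lemma Dec.bind {S : Set (ℝ × ℝ)} {P Q : Set (ℝ × ℝ) → Prop} (h : Dec S P)
    (hPQ : ∀ A B C, P (triangle2 A B C) → Dec (triangle2 A B C) Q) : Dec S Q := by
  obtain ⟨ι, hι, V, hU, hD, hP⟩ := h
  choose κ hκ W hW1 hW2 hW3 using fun i => hPQ _ _ _ (hP i)
  refine ⟨Σ i, κ i, inferInstance, fun x => W x.1 x.2, ?_, ?_, ?_⟩
  · rw [Set.iUnion_sigma, ← hU]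
    exact Set.iUnion_congr hW1
  · rintro ⟨i, x⟩ ⟨j, y⟩ hij
    by_cases h : i = j
    · subst h
      exact hW2 i x y (fun h => hij (by rw [h]))
    · have := hD i j h
      rw [← Set.subset_empty_iff] at this ⊢
      refine (Set.inter_subset_inter (interior_mono ?_) (interior_mono ?_)).trans this
      · rw [← hW1 i]; exact Set.subset_iUnion (fun x => triangle2 (W i x 0) (W i x 1) (W i x 2)) x
      · rw [← hW1 j]; exact Set.subset_iUnion (fun x => triangle2 (W j x 0) (W j x 1) (W j x 2)) y
  · rintro ⟨i, x⟩; exact hW3 i x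

lemma Dec.union {A B C A' B' C' : ℝ × ℝ} {P : Set (ℝ × ℝ) → Prop}
    (h1 : Dec (triangle2 A B C) P) (h2 : Dec (triangle2 A' B' C') P)
    (hd : interior (triangle2 A B C) ∩ interior (triangle2 A' B' C') = ∅) :
    Dec (triangle2 A B C ∪ triangle2 A' B' C') P := by
  have : Dec (triangle2 A B C ∪ triangle2 A' B' C')
      (fun S => S = triangle2 A B C ∨ S = triangle2 A' B' C') := by
    refine ⟨Bool, inferInstance, fun b => if b then ![A, B, C] else ![A', B', C'], ?_, ?_, ?_⟩
    · ext x; simp [or_comm]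
    · intro i j hij
      cases i <;> cases j <;> simp at hij ⊢
      · rw [Set.inter_comm]; exact hd
      · exact hd
    · intro i; cases i <;> simp
  refine this.bind ?_
  rintro X Y Z (h | h) <;> rw [h] <;> assumption

lemma mem_tri {A B C x : ℝ × ℝ} : x ∈ triangle2 A B C ↔
    ∃ a b c : ℝ, 0 ≤ a ∧ 0 ≤ b ∧ 0 ≤ c ∧ a + b + c = 1 ∧ a • A + b • B + c • C = x := by
  unfold triangle2
  rw [convexHull_insert (by simp), convexHull_pair]
  simp only [mem_convexJoin, Set.mem_singleton_iff, exists_eq_left]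
  constructor
  · rintro ⟨y, ⟨s, t, hs, ht, hst, rfl⟩, ⟨u, v, hu, hv, huv, rfl⟩⟩
    refine ⟨u, v * s, v * t, hu, by positivity, by positivity, ?_, ?_⟩
    · rw [add_assoc, ← mul_add, hst, mul_one, huv]
    · simp only [smul_add, smul_smul]; abel
  · rintro ⟨a, b, c, ha, hb, hc, h, rfl⟩
    by_cases h0 : b + c = 0
    · have hb0 : b = 0 := by linarith
      have hc0 : c = 0 := by linarith
      have ha1 : a = 1 := by linarith
      subst hb0 hc0 ha1
      exact ⟨B, left_mem_segment _ _ _, 1, 0, by simp, by simp, by simp, by simp⟩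
    · have hpos : 0 < b + c := lt_of_le_of_ne (by positivity) (Ne.symm h0)
      refine ⟨(b/(b+c)) • B + (c/(b+c)) • C,
        ⟨b/(b+c), c/(b+c), by positivity, by positivity, by field_simp, rfl⟩,
        a, b + c, ha, by positivity, by linarith, ?_⟩
      simp only [smul_add, smul_smul]
      rw [mul_div_cancel₀ _ h0, mul_div_cancel₀ _ h0, add_assoc]

lemma aff_comb3 (d : ℝ × ℝ × ℝ) (A B C : ℝ × ℝ) (a b c : ℝ) (h : a + b + c = 1) :
    aff d (a • A + b • B + c • C) = a * aff d A + b * aff d B + c * aff d C := by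
  have : a = 1 - b - c := by linarith
  subst this
  simp [aff]; ring

lemma aff_nonneg {d : ℝ × ℝ × ℝ} {A B C : ℝ × ℝ} (hA : 0 ≤ aff d A) (hB : 0 ≤ aff d B)
    (hC : 0 ≤ aff d C) : ∀ x ∈ triangle2 A B C, 0 ≤ aff d x := by
  intro x hx
  obtain ⟨a, b, c, ha, hb, hc, h, rfl⟩ := mem_tri.1 hx
  rw [aff_comb3 d A B C a b c h]; positivity

lemma aff_nonpos {d : ℝ × ℝ × ℝ} {A B C : ℝ × ℝ} (hA : aff d A ≤ 0) (hB : aff d B ≤ 0)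
    (hC : aff d C ≤ 0) : ∀ x ∈ triangle2 A B C, aff d x ≤ 0 := by
  intro x hx
  obtain ⟨a, b, c, ha, hb, hc, h, rfl⟩ := mem_tri.1 hx
  rw [aff_comb3 d A B C a b c h]
  have := mul_nonpos_of_nonneg_of_nonpos ha hA
  have := mul_nonpos_of_nonneg_of_nonpos hb hB
  have := mul_nonpos_of_nonneg_of_nonpos hc hC
  linarith

lemma interior_disj {S T : Set (ℝ × ℝ)} (d : ℝ × ℝ × ℝ) (hd : d.1 ≠ 0 ∨ d.2.1 ≠ 0)
    (hS : ∀ x ∈ S, 0 ≤ aff d x) (hT : ∀ x ∈ T, aff d x ≤ 0) :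
    interior S ∩ interior T = ∅ := by
  rw [Set.eq_empty_iff_forall_notMem]
  rintro x ⟨hxS, hxT⟩
  have hc : Tendsto (fun t : ℝ => x + t • (d.1, d.2.1)) (𝓝[>] 0) (𝓝 x) := by
    have : Continuous (fun t : ℝ => x + t • (d.1, d.2.1)) := by fun_prop
    have := this.tendsto 0
    simp only [zero_smul, add_zero] at this
    exact this.mono_left nhdsWithin_le_nhds
  have h2 := hc.eventually (isOpen_interior.mem_nhds hxT)
  obtain ⟨t, ht, ht0⟩ := (h2.and self_mem_nhdsWithin).exists
  have h0 := hS x (interior_subset hxS)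
  have h1 := hT _ (interior_subset ht)
  have hpos : 0 < d.1 ^ 2 + d.2.1 ^ 2 := by
    rcases hd with h | h <;> positivity
  have ht0' : 0 < t := ht0
  have := mul_pos ht0' hpos
  simp only [aff, Prod.fst_add, Prod.snd_add, Prod.smul_fst, Prod.smul_snd, smul_eq_mul] at h0 h1
  nlinarith

lemma split_disj (A B C : ℝ × ℝ) (s t : ℝ) (hs : 0 ≤ s) (ht : 0 ≤ t) (hst : s + t = 1) :
    interior (triangle2 A (s • A + t • B) C) ∩ interior (triangle2 (s • A + t • B) B C) = ∅ := by
  obtain ⟨a1, a2⟩ := A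
  obtain ⟨b1, b2⟩ := B
  obtain ⟨c1, c2⟩ := C
  have hs' : s = 1 - t := by linarith
  subst hs'
  have key : ∀ d : ℝ × ℝ × ℝ, (d.1 ≠ 0 ∨ d.2.1 ≠ 0) → 
     aff d ((1 - t) • (a1, a2) + t • (b1, b2)) = 0 → aff d (c1, c2) = 0 →
     interior (triangle2 (a1, a2) ((1 - t) • (a1, a2) + t • (b1, b2)) (c1, c2)) ∩
      interior (triangle2 ((1 - t) • (a1, a2) + t • (b1, b2)) (b1, b2) (c1, c2)) = ∅ := by
    intro d hd hP hC
    have h := aff_comb d (a1, a2) (b1, b2) (1 - t) t hst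
    rw [hP] at h
    rcases le_total 0 (aff d (a1, a2)) with hA | hA <;>
    rcases le_total 0 (aff d (b1, b2)) with hB | hB
    · by_cases ht0 : t = 0
      · subst ht0
        have hA0 : aff d (a1, a2) = 0 := by linarith
        rw [Set.inter_comm]
        exact interior_disj d hd (aff_nonneg hP.ge hB hC.ge) (aff_nonpos hA0.le hP.le hC.le)
      · have hB0 : aff d (b1, b2) = 0 := by
          have h1 := mul_nonneg hs hA
          have h2 := mul_nonneg ht hB
          have : t * aff d (b1, b2) = 0 := by linarith
          exact (mul_eq_zero.1 this).resolve_left ht0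
        exact interior_disj d hd (aff_nonneg hA hP.ge hC.ge) (aff_nonpos hP.le hB0.le hC.le)
    · exact interior_disj d hd (aff_nonneg hA hP.ge hC.ge) (aff_nonpos hP.le hB hC.le)
    · rw [Set.inter_comm]
      exact interior_disj d hd (aff_nonneg hP.ge hB hC.ge) (aff_nonpos hA hP.le hC.le)
    · by_cases ht0 : t = 0
      · subst ht0
        have hA0 : aff d (a1, a2) = 0 := by linarith
        exact interior_disj d hd (aff_nonneg hA0.ge hP.ge hC.ge) (aff_nonpos hP.le hB hC.le)
      · have hB0 : aff d (b1, b2) = 0 := by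
          have h1 := mul_nonpos_of_nonneg_of_nonpos hs hA
          have h2 := mul_nonpos_of_nonneg_of_nonpos ht hB
          have : t * aff d (b1, b2) = 0 := by linarith
          exact (mul_eq_zero.1 this).resolve_left ht0
        rw [Set.inter_comm]
        exact interior_disj d hd (aff_nonneg hP.ge hB0.ge hC.ge) (aff_nonpos hA hP.le hC.le)
  set p1 := (1 - t) * a1 + t * b1 with hp1
  set p2 := (1 - t) * a2 + t * b2 with hp2
  by_cases h : c1 = p1 ∧ c2 = p2
  · by_cases hab : a1 = b1 ∧ a2 = b2
    · obtain ⟨rfl, rfl⟩ := hab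
      refine key (1, 0, -a1) (by simp) ?_ ?_
      · simp [aff]; ring
      · simp [aff, h.1, hp1]; ring
    · refine key (b2 - a2, -(b1 - a1), -((b2 - a2) * a1) + (b1 - a1) * a2) ?_ ?_ ?_
      · by_contra hcon
        push Not at hcon
        simp only at hcon
        exact hab ⟨by linarith [hcon.2], by linarith [hcon.1]⟩
      · simp [aff]; ring
      · simp [aff, h.1, h.2, hp1, hp2]; ring
  · refine key (c2 - p2, -(c1 - p1), -((c2 - p2) * p1) + (c1 - p1) * p2) ?_ ?_ ?_
    · by_contra hcon
      push Not at hcon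
      simp only at hcon
      exact h ⟨by linarith [hcon.2], by linarith [hcon.1]⟩
    · simp [aff, ← hp1, ← hp2]; ring
    · simp [aff]; ring

lemma split_union (A B C : ℝ × ℝ) (s t : ℝ) (hs : 0 < s) (ht : 0 < t) (hst : s + t = 1) :
    triangle2 A B C = triangle2 A (s • A + t • B) C ∪ triangle2 (s • A + t • B) B C := by
  ext x
  simp only [Set.mem_union, mem_tri]
  constructor
  · rintro ⟨a, b, c, ha, hb, hc, h, rfl⟩
    by_cases hc' : b * s ≤ a * t
    · left
      refine ⟨a - b * s / t, b / t, c, ?_, by positivity, hc, ?_, ?_⟩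
      · rw [sub_nonneg, div_le_iff₀ ht]; exact hc'
      · have hs' : s = 1 - t := by linarith
        subst hs'
        field_simp
        linear_combination t * h
      · ext <;> simp <;> field_simp <;> ring
    · right
      push Not at hc'
      refine ⟨a / s, b - a * t / s, c, by positivity, ?_, hc, ?_, ?_⟩
      · rw [sub_nonneg, div_le_iff₀ hs]; exact hc'.le
      · have hs' : t = 1 - s := by linarith
        subst hs'
        field_simp
        linear_combination s * h
      · ext <;> simp <;> field_simp <;> ring
  · rintro (⟨a, b, c, ha, hb, hc, h, rfl⟩ | ⟨a, b, c, ha, hb, hc, h, rfl⟩)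
    · refine ⟨a + b * s, b * t, c, by positivity, by positivity, hc, ?_, ?_⟩
      · linear_combination h + b * hst
      · ext <;> simp <;> ring
    · refine ⟨a * s, a * t + b, c, by positivity, by positivity, hc, ?_, ?_⟩
      · linear_combination h + a * hst
      · ext <;> simp <;> ring

lemma tri_swap (A B C : ℝ × ℝ) : triangle2 A B C = triangle2 B A C := by
  unfold triangle2; rw [Set.insert_comm]

lemma tri_rot (A B C : ℝ × ℝ) : triangle2 A B C = triangle2 B C A := by
  unfold triangle2; congr 1; ext x; simp; tauto

lemma exists_zero (d : ℝ × ℝ × ℝ) (A B : ℝ × ℝ) (h : aff d A * aff d B < 0) :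
    ∃ s t : ℝ, 0 < s ∧ 0 < t ∧ s + t = 1 ∧ aff d (s • A + t • B) = 0 := by
  have hne : aff d A - aff d B ≠ 0 := by
    intro h0
    have : aff d A = aff d B := by linarith
    rw [this] at h
    nlinarith [mul_self_nonneg (aff d B)]
  have hst : -aff d B / (aff d A - aff d B) + aff d A / (aff d A - aff d B) = 1 := by
    field_simp; ring
  refine ⟨-aff d B / (aff d A - aff d B), aff d A / (aff d A - aff d B), ?_, ?_, hst, ?_⟩
  · rcases mul_neg_iff.1 h with ⟨h1, h2⟩ | ⟨h1, h2⟩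
    · exact div_pos (by linarith) (by linarith)
    · exact div_pos_of_neg_of_neg (by linarith) (by linarith)
  · rcases mul_neg_iff.1 h with ⟨h1, h2⟩ | ⟨h1, h2⟩
    · exact div_pos (by linarith) (by linarith)
    · exact div_pos_of_neg_of_neg (by linarith) (by linarith)
  · rw [aff_comb _ _ _ _ _ hst]; field_simp; ring

lemma sgn_of (d : ℝ × ℝ × ℝ) (A B C : ℝ × ℝ) (h1 : 0 ≤ aff d A * aff d B)
    (h2 : 0 ≤ aff d B * aff d C) (h3 : 0 ≤ aff d A * aff d C) : Sgn d (triangle2 A B C) := by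
  by_cases hp : 0 ≤ aff d A ∧ 0 ≤ aff d B ∧ 0 ≤ aff d C
  · exact Or.inl (aff_nonneg hp.1 hp.2.1 hp.2.2)
  · right
    have : aff d A < 0 ∨ aff d B < 0 ∨ aff d C < 0 := by
      by_contra hcon; push Not at hcon; exact hp hcon
    rcases this with h | h | h
    · exact aff_nonpos h.le (by nlinarith) (by nlinarith)
    · exact aff_nonpos (by nlinarith) h.le (by nlinarith)
    · exact aff_nonpos (by nlinarith) (by nlinarith) h.le

lemma cut_zero (d : ℝ × ℝ × ℝ) (A B C : ℝ × ℝ) (hC : aff d C = 0) :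
    Dec (triangle2 A B C) (Sgn d) := by
  by_cases h : aff d A * aff d B < 0
  · obtain ⟨s, t, hs, ht, hst, h0⟩ := exists_zero d A B h
    rw [split_union A B C s t hs ht hst]
    refine Dec.union (Dec.single (sgn_of _ _ _ _ ?_ ?_ ?_)) (Dec.single (sgn_of _ _ _ _ ?_ ?_ ?_))
      (split_disj A B C s t hs.le ht.le hst) <;> simp [h0, hC]
  · push Not at h
    exact Dec.single (sgn_of _ _ _ _ h (by simp [hC]) (by simp [hC]))

lemma cut_neg (d : ℝ × ℝ × ℝ) (A B C : ℝ × ℝ) (h : aff d A * aff d B < 0) :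
    Dec (triangle2 A B C) (Sgn d) := by
  obtain ⟨s, t, hs, ht, hst, h0⟩ := exists_zero d A B h
  rw [split_union A B C s t hs ht hst]
  refine Dec.union ?_ ?_ (split_disj A B C s t hs.le ht.le hst)
  · rw [tri_swap, tri_rot]; exact cut_zero d _ _ _ h0
  · rw [tri_rot]; exact cut_zero d _ _ _ h0

lemma cut (d : ℝ × ℝ × ℝ) (A B C : ℝ × ℝ) : Dec (triangle2 A B C) (Sgn d) := by
  by_cases h1 : aff d A * aff d B < 0
  · exact cut_neg d A B C h1
  by_cases h2 : aff d B * aff d C < 0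
  · rw [tri_rot]; exact cut_neg d B C A h2
  by_cases h3 : aff d A * aff d C < 0
  · rw [tri_swap, tri_rot]; exact cut_neg d A C B h3
  push Not at h1 h2 h3
  exact Dec.single (sgn_of _ _ _ _ h1 h2 h3)

lemma Dec.mono {S : Set (ℝ × ℝ)} {P Q : Set (ℝ × ℝ) → Prop} (h : Dec S P)
    (hPQ : ∀ T, T ⊆ S → P T → Q T) : Dec S Q := by
  obtain ⟨ι, hι, V, hU, hD, hP⟩ := h
  refine ⟨ι, hι, V, hU, hD, fun i => hPQ _ ?_ (hP i)⟩
  rw [← hU]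
  exact Set.subset_iUnion (fun i => triangle2 (V i 0) (V i 1) (V i 2)) i

lemma Sgn.mono {d : ℝ × ℝ × ℝ} {S T : Set (ℝ × ℝ)} (h : Sgn d S) (hT : T ⊆ S) : Sgn d T :=
  h.imp (fun h x hx => h x (hT hx)) (fun h x hx => h x (hT hx))

lemma cut_list {S : Set (ℝ × ℝ)} {P : Set (ℝ × ℝ) → Prop} (h : Dec S P)
    (L : List (ℝ × ℝ × ℝ)) : Dec S (fun T => ∀ d ∈ L, Sgn d T) := by
  induction L with
  | nil => exact h.mono (by simp)
  | cons d L ih =>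
    refine ih.bind ?_
    intro A B C hP
    refine (cut d A B C).mono ?_
    intro T hT hs e he
    rcases List.mem_cons.1 he with rfl | he
    · exact hs
    · exact (hP e he).mono hT

lemma aff_sub (d e : ℝ × ℝ × ℝ) (p : ℝ × ℝ) : aff (d - e) p = aff d p - aff e p := by
  simp [aff]; ring

lemma continuous_aff (d : ℝ × ℝ × ℝ) : Continuous (aff d) := by
  unfold aff; fun_prop

lemma zero_of_centroid {d : ℝ × ℝ × ℝ} {A B C : ℝ × ℝ} (h : Sgn d (triangle2 A B C))
    (h0 : aff d ((1/3 : ℝ) • A + (1/3 : ℝ) • B + (1/3 : ℝ) • C) = 0) :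
    ∀ x ∈ triangle2 A B C, aff d x = 0 := by
  have hA : A ∈ triangle2 A B C := subset_convexHull ℝ _ (by simp)
  have hB : B ∈ triangle2 A B C := subset_convexHull ℝ _ (by simp)
  have hC : C ∈ triangle2 A B C := subset_convexHull ℝ _ (by simp)
  rw [aff_comb3 _ _ _ _ _ _ _ (by norm_num)] at h0
  intro x hx
  obtain ⟨a, b, c, ha, hb, hc, habc, rfl⟩ := mem_tri.1 hx
  rw [aff_comb3 d A B C a b c habc]
  have : aff d A = 0 ∧ aff d B = 0 ∧ aff d C = 0 := by
    rcases h with h | h <;>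
    · have := h A hA
      have := h B hB
      have := h C hC
      refine ⟨?_, ?_, ?_⟩ <;> linarith
  simp [this.1, this.2.1, this.2.2]

lemma affine_on_tri {f : ℝ × ℝ → ℝ} {A B C : ℝ × ℝ} (hf : ContinuousOn f (triangle2 A B C))
    (L : Finset (ℝ × ℝ × ℝ)) (hL : ∀ x ∈ triangle2 A B C, ∃ d ∈ L, f x = aff d x)
    (hs : ∀ d ∈ L, ∀ e ∈ L, Sgn (d - e) (triangle2 A B C)) :
    ∃ d : ℝ × ℝ × ℝ, ∀ x ∈ triangle2 A B C, f x = aff d x := by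
  classical
  set c := (1/3 : ℝ) • A + (1/3 : ℝ) • B + (1/3 : ℝ) • C with hc
  have hcT : c ∈ triangle2 A B C :=
    mem_tri.2 ⟨1/3, 1/3, 1/3, by norm_num, by norm_num, by norm_num, by norm_num, rfl⟩
  obtain ⟨k, hk, hfk⟩ := hL c hcT
  refine ⟨k, fun p hp => ?_⟩
  have hconv : Convex ℝ (triangle2 A B C) := convex_convexHull ℝ _
  set γ : ℝ → ℝ × ℝ := fun t => (1 - t) • c + t • p with hγ
  have hγc : Continuous γ := by fun_prop
  have hγT : ∀ t ∈ Set.Icc (0:ℝ) 1, γ t ∈ triangle2 A B C := fun t ht =>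
    hconv hcT hp (by linarith [ht.2]) ht.1 (by ring)
  have hfγ : ContinuousOn (fun t => f (γ t)) (Set.Icc 0 1) :=
    hf.comp hγc.continuousOn hγT
  -- nonvanishing
  have hnv : ∀ e ∈ L, aff (e - k) c ≠ 0 → ∀ t ∈ Set.Ico (0:ℝ) 1, aff (e - k) (γ t) ≠ 0 := by
    intro e he hne t ht
    rw [hγ]; simp only
    rw [aff_comb _ _ _ _ _ (by ring)]
    have h1 : 0 < 1 - t := by linarith [ht.2]
    rcases hs e he k hk with h | h
    · have h2 := lt_of_le_of_ne (h c hcT) hne.symm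
      have h3 := mul_nonneg ht.1 (h p hp)
      have := mul_pos h1 h2
      linarith
    · have h2 := lt_of_le_of_ne (h c hcT) hne
      have h3 := mul_nonpos_of_nonneg_of_nonpos ht.1 (h p hp)
      have := mul_neg_of_pos_of_neg h1 h2
      linarith
  have hclosed : ∀ e : ℝ × ℝ × ℝ, IsClosed {t | t ∈ Set.Icc (0:ℝ) 1 ∧ f (γ t) = aff e (γ t)} := by
    intro e
    have : ContinuousOn (fun t => f (γ t) - aff e (γ t)) (Set.Icc 0 1) :=
      hfγ.sub ((continuous_aff e).comp hγc).continuousOn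
    have h2 := this.preimage_isClosed_of_isClosed isClosed_Icc (isClosed_singleton (x := (0:ℝ)))
    convert h2 using 1
    ext t; simp [sub_eq_zero]
  have hmain : ∀ t ∈ Set.Ico (0:ℝ) 1, f (γ t) = aff k (γ t) := by
    intro t ht
    by_contra hne
    have hpc : IsPreconnected (Set.Ico (0:ℝ) 1) := isPreconnected_Ico
    rw [isPreconnected_closed_iff] at hpc
    set J := L.filter (fun e => aff (e - k) c ≠ 0) with hJ
    have hcl2 : IsClosed (⋃ e ∈ J, {t | t ∈ Set.Icc (0:ℝ) 1 ∧ f (γ t) = aff e (γ t)}) :=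
      isClosed_biUnion_finset (fun e _ => hclosed e)
    have hcov : ∀ u ∈ Set.Ico (0:ℝ) 1, f (γ u) = aff k (γ u) ∨
        ∃ e ∈ J, f (γ u) = aff e (γ u) := by
      intro u hu
      obtain ⟨e, he, hfe⟩ := hL (γ u) (hγT u ⟨hu.1, hu.2.le⟩)
      by_cases h0 : aff (e - k) c = 0
      · left
        have := zero_of_centroid (hs e he k hk) h0 _ (hγT u ⟨hu.1, hu.2.le⟩)
        rw [aff_sub] at this
        linarith
      · exact Or.inr ⟨e, Finset.mem_filter.2 ⟨he, h0⟩, hfe⟩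
    obtain ⟨u, hu, hu1, hu2⟩ := hpc _ _ (hclosed k) hcl2 (by
        intro u hu
        rcases hcov u hu with h | ⟨e, he, h⟩
        · exact Or.inl ⟨⟨hu.1, hu.2.le⟩, h⟩
        · exact Or.inr (Set.mem_iUnion₂.2 ⟨e, he, ⟨hu.1, hu.2.le⟩, h⟩))
      ⟨0, by simp, by simp, by simpa [hγ] using hfk⟩
      ⟨t, ht, by
        rcases hcov t ht with h | ⟨e, he, h⟩
        · exact absurd h hne
        · exact Set.mem_iUnion₂.2 ⟨e, he, ⟨ht.1, ht.2.le⟩, h⟩⟩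
    obtain ⟨e, he, -, hfe⟩ := Set.mem_iUnion₂.1 hu2
    obtain ⟨heL, hne'⟩ := Finset.mem_filter.1 he
    apply hnv e heL hne' u hu
    rw [aff_sub, ← hfe, ← hu1.2, sub_self]
  have h1 : (1:ℝ) ∈ closure (Set.Ico (0:ℝ) 1) := by
    rw [closure_Ico (by norm_num)]; simp
  have h2 : closure (Set.Ico (0:ℝ) 1) ⊆ {t | t ∈ Set.Icc (0:ℝ) 1 ∧ f (γ t) = aff k (γ t)} :=
    closure_minimal (fun t ht => ⟨⟨ht.1, ht.2.le⟩, hmain t ht⟩) (hclosed k)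
  have := (h2 h1).2
  simpa [hγ] using this

lemma ql_sel {f : ℝ × ℝ → ℝ} (hf : IsQuasiLinear f) :
    ∃ L : Finset (ℝ × ℝ × ℝ), ∀ x ∈ unitSquare, ∃ d ∈ L, f x = aff d x := by
  classical
  obtain ⟨-, N, V, hU, -, h⟩ := hf
  choose a b c habc using h
  refine ⟨Finset.univ.image (fun i => (a i, b i, c i)), fun x hx => ?_⟩
  rw [← hU] at hx
  obtain ⟨i, hi⟩ := Set.mem_iUnion.1 hx
  exact ⟨(a i, b i, c i), Finset.mem_image.2 ⟨i, Finset.mem_univ i, rfl⟩, habc i x hi⟩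

lemma ql_mid {f g : ℝ × ℝ → ℝ} (hf : IsQuasiLinear f) (hg : IsQuasiLinear g) :
    IsQuasiLinear (fun p => (f p + g p) / 2) := by
  classical
  obtain ⟨L, hL⟩ := ql_sel hf
  obtain ⟨M, hM⟩ := ql_sel hg
  have hcont : ContinuousOn (fun p => (f p + g p) / 2) unitSquare :=
    (hf.1.add hg.1).div_const 2
  refine ⟨hcont, ?_⟩
  obtain ⟨-, N, V, hU, hD, -⟩ := hf
  have h0 : Dec unitSquare (fun _ => True) :=
    ⟨Fin N, inferInstance, V, hU, hD, fun _ => trivial⟩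
  set K : Finset (ℝ × ℝ × ℝ) := (L ×ˢ M).image (fun x => (1/2 : ℝ) • (x.1 + x.2)) with hK
  have hsel : ∀ x ∈ unitSquare, ∃ d ∈ K, (f x + g x) / 2 = aff d x := by
    intro x hx
    obtain ⟨d, hd, h1⟩ := hL x hx
    obtain ⟨e, he, h2⟩ := hM x hx
    refine ⟨(1/2 : ℝ) • (d + e), Finset.mem_image.2 ⟨(d, e), by simp [hd, he], rfl⟩, ?_⟩
    rw [h1, h2]; simp [aff]; ring
  obtain ⟨ι, hι, W, hU', hD', hP⟩ := cut_list h0 ((K ×ˢ K).image (fun x => x.1 - x.2)).toList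
  obtain ⟨n, ⟨e⟩⟩ := Finite.exists_equiv_fin ι
  refine ⟨n, fun i => W (e.symm i), ?_, ?_, ?_⟩
  · rw [← hU']
    exact e.symm.surjective.iUnion_comp (fun i => triangle2 (W i 0) (W i 1) (W i 2))
  · intro i j hij
    exact hD' _ _ (fun h => hij (e.symm.injective h))
  · intro i
    have hsub : triangle2 (W (e.symm i) 0) (W (e.symm i) 1) (W (e.symm i) 2) ⊆ unitSquare := by
      rw [← hU']
      exact Set.subset_iUnion (fun i => triangle2 (W i 0) (W i 1) (W i 2)) (e.symm i)
    obtain ⟨d, hd⟩ := affine_on_tri (hcont.mono hsub) K (fun x hx => hsel x (hsub hx)) (by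
      intro d hd d' hd'
      apply hP (e.symm i)
      rw [Finset.mem_toList, Finset.mem_image]
      exact ⟨(d, d'), by simp [hd, hd'], rfl⟩)
    exact ⟨d.1, d.2.1, d.2.2, hd⟩

/-- integrand -/
noncomputable def igr (f : ℝ × ℝ → ℝ) (p : ℝ × ℝ) : ℝ :=
  Real.sqrt (1 + (fderiv ℝ f p (1, 0)) ^ 2 + (fderiv ℝ f p (0, 1)) ^ 2)

lemma measurable_igr (f : ℝ × ℝ → ℝ) : Measurable (igr f) := by
  unfold igr
  have h1 := measurable_fderiv_apply_const ℝ f (1, 0)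
  have h2 := measurable_fderiv_apply_const ℝ f (0, 1)
  exact ((measurable_const.add (h1.pow_const 2)).add (h2.pow_const 2)).sqrt

lemma ql_ae {f : ℝ × ℝ → ℝ} (hf : IsQuasiLinear f) :
    ∃ M : ℝ, ∀ᵐ p ∂(volume.restrict unitSquare), DifferentiableAt ℝ f p ∧ igr f p ≤ M := by
  obtain ⟨-, N, V, hU, -, h⟩ := hf
  choose a b c habc using h
  refine ⟨∑ i, Real.sqrt (1 + a i ^ 2 + b i ^ 2), ?_⟩
  have hfr : ∀ᵐ p ∂(volume : Measure (ℝ × ℝ)),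
      ∀ i, p ∉ frontier (triangle2 (V i 0) (V i 1) (V i 2)) := by
    rw [ae_all_iff]
    intro i
    exact measure_eq_zero_iff_ae_notMem.1
      (Convex.addHaar_frontier volume (convex_convexHull ℝ _))
  have hm : MeasurableSet unitSquare := measurableSet_Icc
  rw [ae_restrict_iff' hm]
  filter_upwards [hfr] with p hp hpQ
  rw [← hU] at hpQ
  obtain ⟨i, hi⟩ := Set.mem_iUnion.1 hpQ
  have hint : p ∈ interior (triangle2 (V i 0) (V i 1) (V i 2)) := by
    by_contra hcon
    exact hp i ⟨subset_closure hi, hcon⟩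
  have heq : f =ᶠ[𝓝 p] fun q => a i * q.1 + b i * q.2 + c i := by
    filter_upwards [mem_interior_iff_mem_nhds.1 hint] with q hq using habc i q hq
  have hd : HasFDerivAt (fun q : ℝ × ℝ => a i * q.1 + b i * q.2 + c i)
      (a i • ContinuousLinearMap.fst ℝ ℝ ℝ + b i • ContinuousLinearMap.snd ℝ ℝ ℝ) p :=
    ((hasFDerivAt_fst.const_mul (a i)).add (hasFDerivAt_snd.const_mul (b i))).add_const (c i)
  have hd' := hd.congr_of_eventuallyEq heq
  refine ⟨hd'.differentiableAt, ?_⟩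
  unfold igr
  rw [hd'.fderiv]
  simp only [ContinuousLinearMap.add_apply, ContinuousLinearMap.smul_apply,
    ContinuousLinearMap.coe_fst', ContinuousLinearMap.coe_snd', smul_eq_mul, mul_one, mul_zero,
    add_zero, zero_add]
  exact Finset.single_le_sum (f := fun i => Real.sqrt (1 + a i ^ 2 + b i ^ 2))
    (fun j _ => Real.sqrt_nonneg _) (Finset.mem_univ i)

lemma vol_lt_top : volume unitSquare < ⊤ := isCompact_Icc.measure_lt_top

lemma ql_int {f : ℝ × ℝ → ℝ} (hf : IsQuasiLinear f) :
    Integrable (igr f) (volume.restrict unitSquare) := by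
  obtain ⟨M, hM⟩ := ql_ae hf
  haveI : IsFiniteMeasure (volume.restrict unitSquare) :=
    ⟨by rw [Measure.restrict_apply_univ]; exact vol_lt_top⟩
  refine Integrable.of_bound (measurable_igr f).aestronglyMeasurable M ?_
  filter_upwards [hM] with p hp
  rw [Real.norm_of_nonneg (show 0 ≤ igr f p from Real.sqrt_nonneg _)]
  exact hp.2

lemma sqrt_tri (k : ℕ) (a b c : Fin k → ℝ) :
      Real.sqrt ((∑ i, a i) ^ 2 + (∑ i, b i) ^ 2 + (∑ i, c i) ^ 2) ≤
        ∑ i, Real.sqrt ((a i) ^ 2 + (b i) ^ 2 + (c i) ^ 2) := by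
  have h := norm_sum_le Finset.univ (fun i => (!₂[a i, b i, c i] : EuclideanSpace ℝ (Fin 3)))
  simpa [EuclideanSpace.norm_eq, Fin.sum_univ_three] using h

lemma igr_mid {f g : ℝ × ℝ → ℝ} {p : ℝ × ℝ} (hf : DifferentiableAt ℝ f p)
    (hg : DifferentiableAt ℝ g p) :
    igr (fun p => (f p + g p) / 2) p ≤ (igr f p + igr g p) / 2 := by
  have hd : HasFDerivAt (fun p => (f p + g p) / 2)
      ((1/2 : ℝ) • (fderiv ℝ f p + fderiv ℝ g p)) p := by
    have := (hf.hasFDerivAt.add hg.hasFDerivAt).const_mul (1/2 : ℝ)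
    refine this.congr_of_eventuallyEq (Eventually.of_forall fun q => ?_)
    simp; ring
  unfold igr
  rw [hd.fderiv]
  simp only [ContinuousLinearMap.add_apply, ContinuousLinearMap.smul_apply, smul_eq_mul]
  generalize fderiv ℝ f p (1, 0) = a
  generalize fderiv ℝ f p (0, 1) = b
  generalize fderiv ℝ g p (1, 0) = a'
  generalize fderiv ℝ g p (0, 1) = b'
  have h := sqrt_tri 2 ![1, 1] ![a, a'] ![b, b']
  simp only [Fin.sum_univ_two, Matrix.cons_val_zero, Matrix.cons_val_one, one_pow] at h
  have h2 : Real.sqrt (1 + (1/2 * (a + a')) ^ 2 + (1/2 * (b + b')) ^ 2) =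
      Real.sqrt ((1 + 1) ^ 2 + (a + a') ^ 2 + (b + b') ^ 2) / 2 := by
    rw [Real.sqrt_eq_iff_mul_self_eq (by positivity) (by positivity)]
    rw [div_mul_div_comm, Real.mul_self_sqrt (by positivity)]
    ring
  rw [h2]
  exact div_le_div_of_nonneg_right h (by norm_num)

lemma elem_mid {f g : ℝ × ℝ → ℝ} (hf : IsQuasiLinear f) (hg : IsQuasiLinear g) :
    elemArea (fun p => (f p + g p) / 2) ≤ (elemArea f + elemArea g) / 2 := by
  have hF := ql_int hf
  have hG := ql_int hg
  have : (elemArea f + elemArea g) / 2 = ∫ p in unitSquare, (igr f p + igr g p) / 2 := by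
    rw [integral_div, integral_add hF hG]; rfl
  rw [this]
  obtain ⟨_, h1⟩ := ql_ae hf
  obtain ⟨_, h2⟩ := ql_ae hg
  refine integral_mono_of_nonneg (Eventually.of_forall fun p => Real.sqrt_nonneg _)
    ((hF.add hG).div_const 2) ?_
  filter_upwards [h1, h2] with p h1 h2
  exact igr_mid h1.1 h2.1

lemma elem_nonneg (f : ℝ × ℝ → ℝ) : 0 ≤ elemArea f :=
  integral_nonneg fun p => Real.sqrt_nonneg _

lemma exists_of_lt {f : ℝ × ℝ → ℝ} {c : ℝ≥0∞} (h : LebesgueArea f < c) (ε : ℝ) (hε : 0 < ε) :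
    ∃ g, IsQuasiLinear g ∧ (∀ x ∈ unitSquare, dist (f x) (g x) < ε) ∧
      ENNReal.ofReal (elemArea g) < c := by
  obtain ⟨⟨s, hq, hs⟩, hlt⟩ := iInf_lt_iff.1 h
  have h1 := frequently_lt_of_liminf_lt (h := hlt)
  have h2 := Metric.tendstoUniformlyOn_iff.1 hs ε hε
  obtain ⟨n, hn1, hn2⟩ := (h1.and_eventually h2).exists
  exact ⟨s n, hq n, hn2, hn1⟩

lemma le_of_exists {f : ℝ × ℝ → ℝ} {c : ℝ≥0∞}
    (h : ∀ ε : ℝ, 0 < ε → ∃ g, IsQuasiLinear g ∧ (∀ x ∈ unitSquare, dist (f x) (g x) < ε) ∧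
      ENNReal.ofReal (elemArea g) ≤ c) : LebesgueArea f ≤ c := by
  choose g hg1 hg2 hg3 using fun n : ℕ => h (1 / ((n:ℝ) + 1)) (by positivity)
  have hu : TendstoUniformlyOn g f atTop unitSquare := by
    rw [Metric.tendstoUniformlyOn_iff]
    intro ε hε
    have := (tendsto_one_div_add_atTop_nhds_zero_nat (𝕜 := ℝ)).eventually (gt_mem_nhds hε)
    filter_upwards [this] with n hn x hx
    exact (hg2 n x hx).trans hn
  refine (iInf_le _ ⟨g, hg1, hu⟩).trans ?_
  refine (liminf_le_liminf (v := fun _ => c) (Eventually.of_forall hg3)).trans ?_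
  simp

lemma steiner_main (f₁ f₂ : ℝ × ℝ → ℝ) :
      LebesgueArea (fun p => (f₁ p + f₂ p) / 2) ≤
        (LebesgueArea f₁ + LebesgueArea f₂) / 2 := by
  refine ENNReal.le_of_forall_pos_le_add ?_
  intro δ hδ hfin
  have hfin' : LebesgueArea f₁ + LebesgueArea f₂ ≠ ⊤ := by
    intro h; rw [h] at hfin; simp [ENNReal.top_div] at hfin
  have hδ' : (δ : ℝ≥0∞) ≠ 0 := by simpa using hδ.ne'
  have h1 : LebesgueArea f₁ < LebesgueArea f₁ + δ :=
    ENNReal.lt_add_right (ENNReal.add_ne_top.1 hfin').1 hδ'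
  have h2 : LebesgueArea f₂ < LebesgueArea f₂ + δ :=
    ENNReal.lt_add_right (ENNReal.add_ne_top.1 hfin').2 hδ'
  apply le_of_exists
  intro ε hε
  obtain ⟨g₁, hq1, hd1, ha1⟩ := exists_of_lt h1 ε hε
  obtain ⟨g₂, hq2, hd2, ha2⟩ := exists_of_lt h2 ε hε
  refine ⟨_, ql_mid hq1 hq2, ?_, ?_⟩
  · intro x hx
    have e1 := hd1 x hx
    have e2 := hd2 x hx
    rw [Real.dist_eq, abs_lt] at *
    constructor <;> linarith [e1.1, e1.2, e2.1, e2.2]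
  · calc ENNReal.ofReal (elemArea fun p => (g₁ p + g₂ p) / 2)
        ≤ ENNReal.ofReal ((elemArea g₁ + elemArea g₂) / 2) :=
          ENNReal.ofReal_le_ofReal (elem_mid hq1 hq2)
      _ = (ENNReal.ofReal (elemArea g₁) + ENNReal.ofReal (elemArea g₂)) / 2 := by
          rw [ENNReal.ofReal_div_of_pos (by norm_num),
            ENNReal.ofReal_add (elem_nonneg _) (elem_nonneg _)]
          simp
      _ ≤ ((LebesgueArea f₁ + δ) + (LebesgueArea f₂ + δ)) / 2 := by
          gcongr
      _ = (LebesgueArea f₁ + LebesgueArea f₂) / 2 + δ := by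
          rw [add_add_add_comm, ENNReal.add_div]
          congr 1
          rw [← two_mul, mul_comm, ENNReal.mul_div_cancel_right (by norm_num) (by norm_num)]

/-- Steiner's inequality for Lebesgue area: for continuous `f₁, f₂` on `Q`,
`L_Q[(f₁+f₂)/2] ≤ (L_Q[f₁] + L_Q[f₂])/2`; together with the pointwise ingredient
`Σᵢ √(aᵢ² + bᵢ² + cᵢ²) ≥ √((Σaᵢ)² + (Σbᵢ)² + (Σcᵢ)²)`. -/
theorem steiner_inequality :
    (∀ f₁ f₂ : ℝ × ℝ → ℝ, ContinuousOn f₁ unitSquare → ContinuousOn f₂ unitSquare →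
      LebesgueArea (fun p => (f₁ p + f₂ p) / 2) ≤
        (LebesgueArea f₁ + LebesgueArea f₂) / 2) ∧
    (∀ (k : ℕ) (a b c : Fin k → ℝ),
      Real.sqrt ((∑ i, a i) ^ 2 + (∑ i, b i) ^ 2 + (∑ i, c i) ^ 2) ≤
        ∑ i, Real.sqrt ((a i) ^ 2 + (b i) ^ 2 + (c i) ^ 2)) := by
  exact ⟨fun f₁ f₂ _ _ => steiner_main f₁ f₂, sqrt_tri⟩
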